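/- (de Bruijn identity, arbitrary perturbation) Let P be a real random variable with finite variance and smooth density f_P with finite Fisher information, and let Q be independent of P with density symmetric about 0, mean zero, unit variance, and finite moments of all orders. Let f_δ be the density of P + √δ·Q. Then lim_{δ→0⁺} (h(f_δ) − h(f_P))/δ = (1/2) J(f_P). -/

import Mathlib

open MeasureTheory Filter Topology

/-- Differential entropy of a density `f` on `ℝ` (in nats). -/
noncomputable def diffEntropy (f : ℝ → ℝ) : ℝ := -∫ y, f y * Real.log (f y)

/-- Fisher information (with respect to location) of a density `f` on `ℝ`. -/
noncomputable def fisherInfo (f : ℝ → ℝ) : ℝ := ∫ y, (deriv f y) ^ 2 / f y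

/-- Density of `P + √δ Q` when `P`, `Q` are independent with densities `fP`, `fQ`. -/
noncomputable def convPert (fP fQ : ℝ → ℝ) (δ : ℝ) (y : ℝ) : ℝ :=
  ∫ z, fP (y - Real.sqrt δ * z) * fQ z


lemma aux_log_le {r : ℝ} (hr : 1 ≤ r) : Real.log r ≤ (r - 1 / r) / 2 := by
  have h0 : 0 ≤ Real.log r := Real.log_nonneg hr
  have := Real.self_le_sinh_iff.2 h0
  rw [Real.sinh_log (by linarith)] at this
  simpa using this

lemma aux_log_ge {r : ℝ} (hr : 1 ≤ r) : 2 * (r - 1) / (r + 1) ≤ Real.log r := by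
  have := Real.le_log_one_add_of_nonneg (x := r - 1) (by linarith)
  ring_nf at this ⊢
  exact this

/-- lower bound on the Bregman divergence -/
lemma breg_lower {a b : ℝ} (ha : 0 ≤ a) (hb : 0 < b) :
    (a - b) ^ 2 / (2 * max a b) ≤ a * Real.log a - a * Real.log b - a + b := by
  rcases le_total b a with h | h
  · rw [max_eq_left h]
    have ha' : 0 < a := lt_of_lt_of_le hb h
    have := aux_log_ge (r := a / b) ((one_le_div hb).2 h)
    rw [Real.log_div ha'.ne' hb.ne'] at this
    have e : 2 * (a / b - 1) / (a / b + 1) = 2 * (a - b) / (a + b) := by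
      field_simp
    rw [e] at this
    have h2 := mul_le_mul_of_nonneg_left this ha
    have h3 : (a - b) ^ 2 / (2 * a) ≤ a * (2 * (a - b) / (a + b)) - a + b := by
      have : a * (2 * (a - b) / (a + b)) - a + b - (a - b) ^ 2 / (2 * a)
          = (a - b) ^ 3 / (2 * a * (a + b)) := by
        field_simp
        ring
      have h4 : 0 ≤ (a - b) ^ 3 / (2 * a * (a + b)) := by
        have : 0 ≤ a - b := by linarith
        positivity
      linarith
    linarith
  · rw [max_eq_right h]
    rcases ha.eq_or_lt with rfl | ha'
    · simp
      field_simp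
      linarith
    have := aux_log_le (r := b / a) ((one_le_div ha').2 h)
    rw [Real.log_div hb.ne' ha'.ne'] at this
    have h2 := mul_le_mul_of_nonneg_left this ha
    have h3 : (a - b) ^ 2 / (2 * b) = - (a * ((b / a - 1 / (b / a)) / 2)) - a + b := by
      field_simp
      ring
    linarith

lemma breg_nonneg {a b : ℝ} (ha : 0 ≤ a) (hb : 0 < b) :
    0 ≤ a * Real.log a - a * Real.log b - a + b :=
  le_trans (by positivity) (breg_lower ha hb)

/-- upper bound -/
lemma breg_upper {u c L : ℝ} (hu : 0 ≤ u) (hc : 0 < c) (hL : 0 ≤ L)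
    (h : u ≤ c * Real.exp L) :
    u ^ 2 * Real.log (u ^ 2) - u ^ 2 * Real.log (c ^ 2) - u ^ 2 + c ^ 2
      ≤ 2 * (1 + L) * (u - c) ^ 2 := by
  rcases hu.eq_or_lt with rfl | hu'
  · simp
    nlinarith [sq_nonneg c]
  rw [Real.log_pow, Real.log_pow]
  push_cast
  set l := Real.log u - Real.log c with hl
  have hlL : l ≤ L := by
    have := Real.log_le_log hu' h
    rw [Real.log_mul hc.ne' (Real.exp_pos _).ne', Real.log_exp] at this
    linarith
  have goal' : 2 * u ^ 2 * l - u ^ 2 + c ^ 2 ≤ 2 * (1 + L) * (u - c) ^ 2 := by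
    rcases le_total c u with h1 | h1
    · have := aux_log_le (r := u / c) ((one_le_div hc).2 h1)
      rw [Real.log_div hu'.ne' hc.ne', ← hl] at this
      have e : (u / c - 1 / (u / c)) / 2 = (u ^ 2 - c ^ 2) / (2 * u * c) := by
        field_simp
      rw [e, le_div_iff₀ (by positivity)] at this
      have h5 : 2 * (1 + l) * (u - c) ^ 2 ≤ 2 * (1 + L) * (u - c) ^ 2 := by
        gcongr
      refine le_trans ?_ h5
      -- l (4uc - 2c^2) ≤ (3u-c)(u-c)
      have h6 : l * (4 * u * c - 2 * c ^ 2) * u ≤ (3 * u - c) * (u - c) * u := by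
        have h7 : l * (2 * u * c) * (2 * u - c) ≤ (u ^ 2 - c ^ 2) * (2 * u - c) :=
          mul_le_mul_of_nonneg_right (by linarith) (by linarith)
        nlinarith [mul_nonneg (sub_nonneg.2 h1) (sq_nonneg (u - c))]
      have h8 := le_of_mul_le_mul_right h6 hu'
      nlinarith
    · have := aux_log_ge (r := c / u) ((one_le_div hu').2 h1)
      rw [Real.log_div hc.ne' hu'.ne'] at this
      have e : 2 * (c / u - 1) / (c / u + 1) = 2 * (c - u) / (c + u) := by
        field_simp
      have e2 : Real.log c - Real.log u = - l := by rw [hl]; ring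
      rw [e, e2, div_le_iff₀ (by positivity)] at this
      have h5 : 2 * (u - c) ^ 2 ≤ 2 * (1 + L) * (u - c) ^ 2 := by
        nlinarith [mul_nonneg hL (sq_nonneg (u - c))]
      refine le_trans ?_ h5
      have h6 : (2 * u ^ 2 * l - u ^ 2 + c ^ 2) * (c + u) ≤ (2 * (u - c) ^ 2) * (c + u) := by
        nlinarith [mul_nonneg (sub_nonneg.2 h1) (sq_nonneg (u - c)), mul_le_mul_of_nonneg_left this (sq_nonneg u)]
      exact le_of_mul_le_mul_right h6 (by positivity)
  calc _ = 2 * u ^ 2 * l - u ^ 2 + c ^ 2 := by rw [hl]; ring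
    _ ≤ _ := goal'

lemma cs_aux {α : Type*} [MeasurableSpace α] (ν : Measure α) (p k : α → ℝ) (hk : ∀ x, 0 ≤ k x)
    (h0 : Integrable k ν) (h1 : Integrable (fun x => p x * k x) ν)
    (h2 : Integrable (fun x => p x ^ 2 * k x) ν) (hK : 0 < ∫ x, k x ∂ν) :
    (∫ x, p x * k x ∂ν) ^ 2 ≤ (∫ x, k x ∂ν) * ∫ x, p x ^ 2 * k x ∂ν := by
  set K := ∫ x, k x ∂ν
  set A := ∫ x, p x * k x ∂ν with hA
  set B := ∫ x, p x ^ 2 * k x ∂ν with hB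
  have h : 0 ≤ ∫ x, (p x - A / K) ^ 2 * k x ∂ν :=
    integral_nonneg fun x => mul_nonneg (sq_nonneg _) (hk x)
  have e : ∫ x, (p x - A / K) ^ 2 * k x ∂ν = B - 2 * (A / K) * A + (A / K) ^ 2 * K := by
    have : (fun x => (p x - A / K) ^ 2 * k x) = fun x =>
        (p x ^ 2 * k x - 2 * (A / K) * (p x * k x)) + (A / K) ^ 2 * k x := by
      ext x; ring
    have i1 : Integrable (fun x => p x ^ 2 * k x - 2 * (A / K) * (p x * k x)) ν :=
      h2.sub (h1.const_mul _)
    rw [this, integral_add i1 (h0.const_mul _),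
      integral_sub h2 (h1.const_mul _), integral_const_mul, integral_const_mul]
  rw [e] at h
  have : B - 2 * (A / K) * A + (A / K) ^ 2 * K = B - A ^ 2 / K := by
    field_simp
    ring
  rw [this] at h
  have : A ^ 2 / K ≤ B := by linarith
  rw [div_le_iff₀ hK] at this
  linarith

noncomputable def hscore (f : ℝ → ℝ) (y : ℝ) : ℝ := deriv f y / (2 * Real.sqrt (f y))

lemma deriv_zero_of_zero {f : ℝ → ℝ} (hpos : ∀ y, 0 ≤ f y) {y : ℝ} (h : f y = 0) :
    deriv f y = 0 := by
  apply IsLocalMin.deriv_eq_zero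
  filter_upwards with x
  rw [h]; exact hpos x

lemma hscore_meas {f : ℝ → ℝ} (hf : ContDiff ℝ 1 f) : Measurable (hscore f) := by
  unfold hscore
  have h1 : Measurable (deriv f) := measurable_deriv f
  have h2 : Measurable f := hf.continuous.measurable
  fun_prop

lemma hscore_sq {f : ℝ → ℝ} (hpos : ∀ y, 0 ≤ f y) (y : ℝ) :
    hscore f y ^ 2 = (1 / 4) * ((deriv f y) ^ 2 / f y) := by
  unfold hscore
  rw [div_pow, mul_pow, Real.sq_sqrt (hpos y)]
  ring

lemma hscore_sq_int {f : ℝ → ℝ} (hpos : ∀ y, 0 ≤ f y)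
    (hJ : Integrable (fun y => (deriv f y) ^ 2 / f y)) :
    Integrable (fun y => hscore f y ^ 2) := by
  simp_rw [hscore_sq hpos]
  exact hJ.const_mul _

lemma hscore_locint {f : ℝ → ℝ} (hf : ContDiff ℝ 1 f) (hpos : ∀ y, 0 ≤ f y)
    (hJ : Integrable (fun y => (deriv f y) ^ 2 / f y)) (a b : ℝ) :
    IntervalIntegrable (fun t => |hscore f t|) volume a b := by
  have h1 : IntervalIntegrable (fun t => 1 + hscore f t ^ 2) volume a b :=
    (intervalIntegrable_const).add (hscore_sq_int hpos hJ).intervalIntegrable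
  refine h1.mono_fun' ?_ ?_
  · exact ((hscore_meas hf).abs).aestronglyMeasurable
  · refine ae_of_all _ fun t => ?_
    simp only [Real.norm_eq_abs, abs_abs]
    nlinarith [sq_nonneg (|hscore f t| - 1), sq_abs (hscore f t), abs_nonneg (hscore f t)]

lemma sqrt_diff {f : ℝ → ℝ} (hf : ContDiff ℝ 1 f) (hpos : ∀ y, 0 ≤ f y)
    (hJ : Integrable (fun y => (deriv f y) ^ 2 / f y)) (x y : ℝ) :
    |Real.sqrt (f x) - Real.sqrt (f y)| ≤ |(∫ t in y..x, |hscore f t|)| := by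
  have key : ∀ η : ℝ, 0 < η →
      |Real.sqrt (f x + η) - Real.sqrt (f y + η)| ≤ |(∫ t in y..x, |hscore f t|)| := by
    intro η hη
    have hd : ∀ t, HasDerivAt (fun t => Real.sqrt (f t + η))
        (deriv f t / (2 * Real.sqrt (f t + η))) t := by
      intro t
      have h1 : HasDerivAt (fun t => f t + η) (deriv f t) t :=
        ((hf.differentiable (by norm_num)).differentiableAt.hasDerivAt).add_const η
      exact h1.sqrt (by have := hpos t; positivity)
    have hc : Continuous (fun t => deriv f t / (2 * Real.sqrt (f t + η))) := by
      have h1 : Continuous (deriv f) := hf.continuous_deriv (by norm_num)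
      have h2 := hf.continuous
      refine h1.div (by fun_prop) ?_
      intro t
      have := hpos t
      positivity
    have := intervalIntegral.integral_eq_sub_of_hasDerivAt (fun t _ => hd t)
      (hc.intervalIntegrable y x)
    rw [← this]
    have := intervalIntegral.norm_integral_le_abs_of_norm_le (μ := volume) (a := y) (b := x)
      (f := fun t => deriv f t / (2 * Real.sqrt (f t + η))) (g := fun t => |hscore f t|)
      (ae_of_all _ fun t => ?_) (hscore_locint hf hpos hJ y x)
    · simpa using this
    · simp only [Real.norm_eq_abs, hscore]
      rcases (hpos t).eq_or_lt with h0 | h0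
      · rw [deriv_zero_of_zero hpos h0.symm]; simp
      · rw [abs_div, abs_div]
        gcongr
        linarith
  have ht : Tendsto (fun η : ℝ => |Real.sqrt (f x + η) - Real.sqrt (f y + η)|) (𝓝[>] 0)
      (𝓝 |Real.sqrt (f x) - Real.sqrt (f y)|) := by
    have : Continuous (fun η : ℝ => |Real.sqrt (f x + η) - Real.sqrt (f y + η)|) := by fun_prop
    have := this.tendsto 0
    simp only [add_zero] at this
    exact this.mono_left nhdsWithin_le_nhds
  refine le_of_tendsto ht ?_
  filter_upwards [self_mem_nhdsWithin] with η hη using key η hη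

lemma bounded_f {f : ℝ → ℝ} (hf : ContDiff ℝ 1 f) (hpos : ∀ y, 0 ≤ f y) (hint : Integrable f)
    (hJ : Integrable (fun y => (deriv f y) ^ 2 / f y)) : ∃ M : ℝ, 0 < M ∧ ∀ y, f y ≤ M := by
  have hder : Integrable (deriv f) := by
    refine (hint.add hJ).mono' (measurable_deriv f).aestronglyMeasurable (ae_of_all _ fun t => ?_)
    simp only [Real.norm_eq_abs, Pi.add_apply]
    rcases (hpos t).eq_or_lt with h0 | h0
    · rw [deriv_zero_of_zero hpos h0.symm]; simp [hpos t]
    · have : f t + deriv f t ^ 2 / f t - |deriv f t| =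
        ((f t - |deriv f t| / 2) ^ 2 + 3 / 4 * |deriv f t| ^ 2) / f t := by
        rw [← sq_abs (deriv f t)]
        field_simp
        ring
      have h2 : 0 ≤ ((f t - |deriv f t| / 2) ^ 2 + 3 / 4 * |deriv f t| ^ 2) / f t := by
        positivity
      linarith
  refine ⟨f 0 + (∫ t, |deriv f t|) + 1, ?_, fun y => ?_⟩
  · have := hpos 0
    have : 0 ≤ ∫ t, |deriv f t| := integral_nonneg fun t => abs_nonneg _
    linarith
  · have := intervalIntegral.integral_eq_sub_of_hasDerivAt (a := 0) (b := y) (f := f)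
      (fun t _ => (hf.differentiable (by norm_num)).differentiableAt.hasDerivAt)
      hder.intervalIntegrable
    have h1 : ∫ t in (0:ℝ)..y, deriv f t ≤ ∫ t, |deriv f t| := by
      calc _ ≤ ‖∫ t in (0:ℝ)..y, deriv f t‖ := Real.le_norm_self _
        _ ≤ ∫ t in Set.uIoc 0 y, ‖deriv f t‖ := intervalIntegral.norm_integral_le_integral_norm_uIoc
        _ ≤ _ := setIntegral_le_integral hder.norm (ae_of_all _ fun t => norm_nonneg _)
    linarith

/-- L2 modulus of continuity -/
lemma l2_shift {f : ℝ → ℝ} (hf : ContDiff ℝ 1 f) (hpos : ∀ y, 0 ≤ f y)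
    (hJ : Integrable (fun y => (deriv f y) ^ 2 / f y)) (h : ℝ) :
    ∫⁻ y, ENNReal.ofReal ((Real.sqrt (f (y - h)) - Real.sqrt (f y)) ^ 2)
      ≤ ENNReal.ofReal (h ^ 2 * ∫ y, hscore f y ^ 2) := by
  have hw := hscore_meas hf
  have hw2 := hscore_sq_int hpos hJ
  have hae : ∀ᵐ y : ℝ, IntegrableOn (fun θ => hscore f (y - h * θ) ^ 2) (Set.Ioc 0 1) := by
    rcases eq_or_ne h 0 with rfl | hh
    · simp
    · refine ae_of_all _ fun y => ?_
      have := ((hw2.comp_sub_left y).comp_mul_left' hh)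
      exact this.integrableOn
  have pt : ∀ᵐ y : ℝ, ENNReal.ofReal ((Real.sqrt (f (y - h)) - Real.sqrt (f y)) ^ 2)
      ≤ ∫⁻ θ in Set.Ioc (0:ℝ) 1, ENNReal.ofReal (h ^ 2 * hscore f (y - h * θ) ^ 2) := by
    filter_upwards [hae] with y hy
    rw [← ofReal_integral_eq_lintegral_ofReal (hy.const_mul _)
      (ae_of_all _ fun θ => by positivity)]
    apply ENNReal.ofReal_le_ofReal
    rw [integral_const_mul]
    have h1 := sqrt_diff hf hpos hJ (y - h) y
    have h2 := intervalIntegral.mul_integral_comp_sub_mul (a := 0) (b := 1)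
      (f := fun t => |hscore f t|) h y
    simp only [mul_one, mul_zero, sub_zero] at h2
    rw [intervalIntegral.integral_symm, ← h2, abs_neg, abs_mul] at h1
    have hi1 : Integrable (fun θ => |hscore f (y - h * θ)|) (volume.restrict (Set.Ioc 0 1)) := by
      refine (((integrable_const (1:ℝ)).add hy)).mono' ?_ ?_
      · have : Measurable (fun θ => |hscore f (y - h * θ)|) := by
          have := hw.comp (g := hscore f) (f := fun θ : ℝ => y - h * θ) (by fun_prop)
          exact this.abs
        exact this.aestronglyMeasurable
      · refine ae_of_all _ fun θ => ?_
        simp only [Real.norm_eq_abs, abs_abs, Pi.add_apply]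
        nlinarith [sq_nonneg (|hscore f (y - h * θ)| - 1), sq_abs (hscore f (y - h * θ)), abs_nonneg (hscore f (y - h * θ))]
    have h3 := cs_aux (volume.restrict (Set.Ioc (0:ℝ) 1)) (fun θ => |hscore f (y - h * θ)|)
      (fun _ => 1) (by simp) (integrable_const _) (by simpa using hi1) (by simp only [mul_one, sq_abs]; exact hy)
      (by simp)
    simp only [mul_one, sq_abs, integral_const, smul_eq_mul] at h3
    simp at h3
    rw [intervalIntegral.integral_of_le zero_le_one] at h1
    calc _ = |Real.sqrt (f (y - h)) - Real.sqrt (f y)| ^ 2 := (sq_abs _).symm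
      _ ≤ (|h| * |(∫ θ in Set.Ioc (0:ℝ) 1, |hscore f (y - h * θ)|)|) ^ 2 := by
        gcongr
      _ = h ^ 2 * (∫ θ in Set.Ioc (0:ℝ) 1, |hscore f (y - h * θ)|) ^ 2 := by
        rw [mul_pow, sq_abs, sq_abs]
      _ ≤ _ := by gcongr
  calc _ ≤ ∫⁻ y, ∫⁻ θ in Set.Ioc (0:ℝ) 1, ENNReal.ofReal (h ^ 2 * hscore f (y - h * θ) ^ 2) :=
        lintegral_mono_ae pt
    _ = ∫⁻ θ in Set.Ioc (0:ℝ) 1, ∫⁻ y, ENNReal.ofReal (h ^ 2 * hscore f (y - h * θ) ^ 2) := by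
        apply lintegral_lintegral_swap
        have : Measurable (fun p : ℝ × ℝ => hscore f (p.1 - h * p.2)) :=
          hw.comp (g := hscore f) (f := fun p : ℝ × ℝ => p.1 - h * p.2) (by fun_prop)
        exact ((this.pow_const 2).const_mul _).ennreal_ofReal.aemeasurable
    _ = ∫⁻ θ in Set.Ioc (0:ℝ) 1, ENNReal.ofReal (h ^ 2 * ∫ y, hscore f y ^ 2) := by
        congr 1; ext θ
        rw [lintegral_sub_right_eq_self (fun y => ENNReal.ofReal (h ^ 2 * hscore f y ^ 2)) (h * θ),
          ← ofReal_integral_eq_lintegral_ofReal (hw2.const_mul _)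
          (ae_of_all _ fun θ => by positivity), integral_const_mul]
    _ = _ := by simp

lemma int_exp_abs : Integrable (fun x : ℝ => Real.exp (-|x|)) := by
  rw [← integrableOn_univ, ← Set.Iic_union_Ioi (a := (0:ℝ))]
  refine IntegrableOn.union ?_ ?_
  · refine (integrableOn_exp_Iic 0).congr_fun (fun x hx => ?_) measurableSet_Iic
    simp only [abs_of_nonpos (Set.mem_Iic.1 hx), neg_neg]
  · refine (exp_neg_integrableOn_Ioi 0 one_pos).congr_fun (fun x hx => ?_) measurableSet_Ioi
    simp only [abs_of_pos (Set.mem_Ioi.1 hx)]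
    ring_nf

noncomputable def KK : ℝ := ∫ v : ℝ, Real.exp (-|v|)

lemma KK_pos : 0 < KK := by
  unfold KK
  rw [integral_pos_iff_support_of_nonneg (fun v => (Real.exp_pos _).le) int_exp_abs]
  have : Function.support (fun v : ℝ => Real.exp (-|v|)) = Set.univ := by
    ext v; simp [(Real.exp_pos _).ne']
  rw [this]; simp

/-- truncated score -/
noncomputable def pp (f : ℝ → ℝ) (r y t : ℝ) : ℝ := max (|hscore f t| - Real.sqrt (f y) / r) 0

lemma pp_nonneg (f : ℝ → ℝ) (r y t : ℝ) : 0 ≤ pp f r y t := le_max_right _ _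

lemma pp_le (f : ℝ → ℝ) {r : ℝ} (hr : 0 < r) (y t : ℝ) : pp f r y t ≤ |hscore f t| := by
  refine max_le ?_ (abs_nonneg _)
  have : 0 ≤ Real.sqrt (f y) / r := by positivity
  linarith

lemma pp_sq_le (f : ℝ → ℝ) {r : ℝ} (hr : 0 < r) (y t : ℝ) : pp f r y t ^ 2 ≤ hscore f t ^ 2 := by
  rw [← sq_abs (hscore f t)]
  exact pow_le_pow_left₀ (pp_nonneg _ _ _ _) (pp_le f hr y t) 2

lemma pp_meas {f : ℝ → ℝ} (hf : ContDiff ℝ 1 f) (r : ℝ) :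
    Measurable (fun q : ℝ × ℝ => pp f r q.1 q.2) := by
  unfold pp
  have := hscore_meas hf
  have := hf.continuous.measurable
  fun_prop

noncomputable def EE (f : ℝ → ℝ) (r y : ℝ) : ℝ :=
  ∫ v, pp f r y (y + r * v) ^ 2 * Real.exp (-|v|)

noncomputable def DD (f : ℝ → ℝ) (r y : ℝ) : ℝ :=
  r * ∫ v, pp f r y (y + r * v) * Real.exp (-|v|)

section
variable {f : ℝ → ℝ} (hf : ContDiff ℝ 1 f) (hpos : ∀ y, 0 ≤ f y)
    (hJ : Integrable (fun y => (deriv f y) ^ 2 / f y)) {r : ℝ} (hr : 0 < r) 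

lemma EE_int (y : ℝ) (hf : ContDiff ℝ 1 f) (hpos : ∀ y, 0 ≤ f y)
    (hJ : Integrable (fun y => (deriv f y) ^ 2 / f y)) (hr : 0 < r)  :
    Integrable (fun v => pp f r y (y + r * v) ^ 2 * Real.exp (-|v|)) := by
  have h1 : Integrable (fun v => hscore f (y + r * v) ^ 2) :=
    (((hscore_sq_int hpos hJ).comp_add_left y).comp_mul_left' hr.ne')
  have hm : Measurable (fun v : ℝ => pp f r y (y + r * v)) :=
    (pp_meas hf r).comp (f := fun v : ℝ => (y, y + r * v)) (by fun_prop)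
  refine h1.mono' (by fun_prop) (ae_of_all _ fun v => ?_)
  rw [Real.norm_eq_abs, abs_of_nonneg (by positivity)]
  calc _ ≤ pp f r y (y + r * v) ^ 2 * 1 := by
        gcongr
        exact Real.exp_le_one_iff.2 (by simp)
    _ ≤ _ := by rw [mul_one]; exact pp_sq_le f hr _ _

lemma DD_int (y : ℝ) (hf : ContDiff ℝ 1 f) (hpos : ∀ y, 0 ≤ f y)
    (hJ : Integrable (fun y => (deriv f y) ^ 2 / f y)) (hr : 0 < r)  :
    Integrable (fun v => pp f r y (y + r * v) * Real.exp (-|v|)) := by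
  have hm : Measurable (fun v : ℝ => pp f r y (y + r * v)) :=
    (pp_meas hf r).comp (f := fun v : ℝ => (y, y + r * v)) (by fun_prop)
  refine ((EE_int y hf hpos hJ hr).add int_exp_abs).mono' (by fun_prop) (ae_of_all _ fun v => ?_)
  have := pp_nonneg f r y (y + r * v)
  rw [Real.norm_eq_abs, abs_of_nonneg (by positivity)]
  simp only [Pi.add_apply]
  have h2 := Real.exp_pos (-|v|)
  nlinarith [sq_nonneg (pp f r y (y + r * v) - 1)]

lemma DD_nonneg (y : ℝ) (hr : 0 < r) : 0 ≤ DD f r y :=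
  mul_nonneg hr.le (integral_nonneg fun v => mul_nonneg (pp_nonneg _ _ _ _) (Real.exp_pos _).le)

lemma DD_sq (y : ℝ) (hf : ContDiff ℝ 1 f) (hpos : ∀ y, 0 ≤ f y)
    (hJ : Integrable (fun y => (deriv f y) ^ 2 / f y)) (hr : 0 < r)  :
    DD f r y ^ 2 ≤ r ^ 2 * (KK * EE f r y) := by
  unfold DD EE
  rw [mul_pow]
  gcongr
  exact cs_aux volume _ _ (fun v => (Real.exp_pos _).le) int_exp_abs (DD_int y hf hpos hJ hr)
    (EE_int y hf hpos hJ hr) KK_pos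

lemma DD_bound (x y : ℝ) (hf : ContDiff ℝ 1 f) (hpos : ∀ y, 0 ≤ f y)
    (hJ : Integrable (fun y => (deriv f y) ^ 2 / f y)) (hr : 0 < r)  :
    Real.sqrt (f x) ≤ (Real.sqrt (f y) + DD f r y) * Real.exp (|x - y| / r) := by
  set k := Real.sqrt (f y) with hk
  have hk0 : 0 ≤ k := Real.sqrt_nonneg _
  set d := |x - y| / r with hd
  have hd0 : 0 ≤ d := by positivity
  -- change of variables
  have hint : Integrable (fun t => pp f r y t * Real.exp (-|(t - y) / r|)) := by
    have h1 := DD_int y hf hpos hJ hr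
    have h2 : Integrable (fun t => (fun v => pp f r y (y + r * v) * Real.exp (-|v|)) (r⁻¹ * (t - y))) :=
      (h1.comp_mul_left' (R := r⁻¹) (by positivity)).comp_sub_right y
    refine h2.congr (ae_of_all _ fun t => ?_)
    simp only
    have e1 : r * (r⁻¹ * (t - y)) = t - y := by field_simp
    have e2 : r⁻¹ * (t - y) = (t - y) / r := by field_simp
    rw [e1, e2]; simp
  have hDD : DD f r y = ∫ t, pp f r y t * Real.exp (-|(t - y) / r|) := by
    have h1 := Measure.integral_comp_mul_left
      (fun t => pp f r y (t + y) * Real.exp (-|t / r|)) r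
    have h2 := integral_sub_right_eq_self (μ := volume)
      (fun t => pp f r y (t + y) * Real.exp (-|t / r|)) y
    simp only [sub_add_cancel] at h2
    rw [h2, DD]
    have h3 : (fun v => pp f r y (y + r * v) * Real.exp (-|v|)) =
        fun x => pp f r y (r * x + y) * Real.exp (-|r * x / r|) := by
      ext v
      have : r * v / r = v := by field_simp
      rw [this, add_comm]
    rw [h3, h1, abs_of_pos (by positivity), smul_eq_mul]
    field_simp
  have hwS : IntegrableOn (fun t => |hscore f t|) (Set.uIoc y x) :=
    intervalIntegrable_iff.1 (hscore_locint hf hpos hJ y x)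
  have hpS : IntegrableOn (fun t => pp f r y t) (Set.uIoc y x) := by
    have hm : Measurable (fun t : ℝ => pp f r y t) :=
      (pp_meas hf r).comp (f := fun t : ℝ => (y, t)) (by fun_prop)
    refine hwS.mono' hm.aestronglyMeasurable (ae_of_all _ fun t => ?_)
    rw [Real.norm_eq_abs, abs_of_nonneg (pp_nonneg _ _ _ _)]
    exact pp_le f hr y t
  have hS : ∫ t in Set.uIoc y x, pp f r y t ≤ Real.exp d * DD f r y := by
    calc ∫ t in Set.uIoc y x, pp f r y t
        ≤ ∫ t in Set.uIoc y x, Real.exp d * (pp f r y t * Real.exp (-|(t - y) / r|)) := by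
          refine setIntegral_mono_on hpS (hint.const_mul _).integrableOn
            measurableSet_uIoc fun t ht => ?_
          have h5 : |(t - y) / r| ≤ d := by
            rw [abs_div, abs_of_pos hr, hd]
            gcongr ?_ / r
            exact Set.abs_sub_left_of_mem_uIcc (Set.uIoc_subset_uIcc ht)
          have h6 : 1 ≤ Real.exp d * Real.exp (-|(t - y) / r|) := by
            rw [← Real.exp_add]
            exact Real.one_le_exp (by linarith)
          nlinarith [pp_nonneg f r y t]
      _ ≤ ∫ t, Real.exp d * (pp f r y t * Real.exp (-|(t - y) / r|)) := by
          refine setIntegral_le_integral (hint.const_mul _) (ae_of_all _ fun t => ?_)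
          have := pp_nonneg f r y t
          simp only [Pi.zero_apply]
          positivity
      _ = _ := by rw [integral_const_mul, ← hDD]
  have h1 : |(∫ t in y..x, |hscore f t|)| ≤ (∫ t in Set.uIoc y x, pp f r y t) + k * d := by
    rw [intervalIntegral.abs_integral_eq_abs_integral_uIoc,
      abs_of_nonneg (integral_nonneg fun t => abs_nonneg _)]
    have hc : IntegrableOn (fun _ : ℝ => k / r) (Set.uIoc y x) := by
      refine integrableOn_const ?_
      simp
    calc ∫ t in Set.uIoc y x, |hscore f t| ≤ ∫ t in Set.uIoc y x, (pp f r y t + k / r) := by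
          refine setIntegral_mono hwS (hpS.add hc) fun t => ?_
          have := le_max_left (|hscore f t| - Real.sqrt (f y) / r) 0
          simp only [pp]
          linarith
      _ = _ := by
          rw [integral_add hpS hc, setIntegral_const, smul_eq_mul, hd, measureReal_def,
            Real.volume_uIoc, ENNReal.toReal_ofReal (abs_nonneg _)]
          ring
  have h2 := sqrt_diff hf hpos hJ x y
  have h3 : Real.sqrt (f x) ≤ k + |(∫ t in y..x, |hscore f t|)| := by
    have := le_abs_self (Real.sqrt (f x) - Real.sqrt (f y))
    linarith
  have h4 : k * (d + 1) ≤ k * Real.exp d := by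
    gcongr; exact Real.add_one_le_exp d
  nlinarith
end

lemma EE_tendsto {f : ℝ → ℝ} (hf : ContDiff ℝ 1 f) (hpos : ∀ y, 0 ≤ f y)
    (hJ : Integrable (fun y => (deriv f y) ^ 2 / f y)) :
    Tendsto (fun r => ∫⁻ y, ENNReal.ofReal (EE f r y)) (𝓝[>] 0) (𝓝 0) := by
  have hw := hscore_meas hf
  have hw2 := hscore_sq_int hpos hJ
  let F : ℝ → ℝ × ℝ → ENNReal := fun r q =>
    ENNReal.ofReal (pp f r (q.2 - r * q.1) q.2 ^ 2 * Real.exp (-|q.1|))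
  have hFm : ∀ r, Measurable (F r) := by
    intro r
    have : Measurable (fun q : ℝ × ℝ => pp f r (q.2 - r * q.1) q.2) :=
      (pp_meas hf r).comp (f := fun q : ℝ × ℝ => (q.2 - r * q.1, q.2)) (by fun_prop)
    exact ((this.pow_const 2).mul (by fun_prop)).ennreal_ofReal
  have e : ∀ r : ℝ, 0 < r → ∫⁻ y, ENNReal.ofReal (EE f r y) = ∫⁻ q, F r q ∂(volume.prod volume) := by
    intro r hr
    rw [lintegral_prod _ (hFm r).aemeasurable]
    calc _ = ∫⁻ y, ∫⁻ v, ENNReal.ofReal (pp f r y (y + r * v) ^ 2 * Real.exp (-|v|)) := by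
          congr 1; ext y
          rw [EE, ofReal_integral_eq_lintegral_ofReal (EE_int y hf hpos hJ hr)
            (ae_of_all _ fun v => by positivity)]
      _ = ∫⁻ v, ∫⁻ y, ENNReal.ofReal (pp f r y (y + r * v) ^ 2 * Real.exp (-|v|)) := by
          apply lintegral_lintegral_swap
          have : Measurable (fun q : ℝ × ℝ => pp f r q.1 (q.1 + r * q.2)) :=
            (pp_meas hf r).comp (f := fun q : ℝ × ℝ => (q.1, q.1 + r * q.2)) (by fun_prop)
          exact ((this.pow_const 2).mul (by fun_prop)).ennreal_ofReal.aemeasurable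
      _ = _ := by
          congr 1; ext v
          rw [← lintegral_sub_right_eq_self (fun y => ENNReal.ofReal (pp f r y (y + r * v) ^ 2 * Real.exp (-|v|))) (r * v)]
          simp [F]
  have hlim : Tendsto (fun r => ∫⁻ q, F r q ∂(volume.prod volume)) (𝓝[>] 0)
      (𝓝 (∫⁻ q : ℝ × ℝ, 0 ∂(volume.prod volume))) := by
    refine tendsto_lintegral_filter_of_dominated_convergence
      (fun q : ℝ × ℝ => ENNReal.ofReal (Real.exp (-|q.1|) * hscore f q.2 ^ 2))
      (Eventually.of_forall hFm) ?_ ?_ ?_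
    · filter_upwards [self_mem_nhdsWithin] with r hr
      refine ae_of_all _ fun q => ?_
      apply ENNReal.ofReal_le_ofReal
      rw [mul_comm]
      gcongr ?_ * ?_
      exact pp_sq_le f hr _ _
    · have : Integrable (fun q : ℝ × ℝ => Real.exp (-|q.1|) * hscore f q.2 ^ 2) (volume.prod volume) :=
        int_exp_abs.mul_prod hw2
      exact this.lintegral_lt_top.ne
    · refine ae_of_all _ fun q => ?_
      have : ∀ᶠ r in 𝓝[>] (0:ℝ), pp f r (q.2 - r * q.1) q.2 = 0 := by
        rcases (hpos q.2).eq_or_lt with h0 | h0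
        · filter_upwards [self_mem_nhdsWithin] with r hr
          have : hscore f q.2 = 0 := by
            unfold hscore; rw [deriv_zero_of_zero hpos h0.symm]; simp
          refine le_antisymm ?_ (pp_nonneg _ _ _ _)
          simpa [this] using pp_le f hr (q.2 - r * q.1) q.2
        · have h1 : Tendsto (fun r : ℝ => Real.sqrt (f (q.2 - r * q.1))) (𝓝[>] 0)
              (𝓝 (Real.sqrt (f q.2))) := by
            have : Continuous (fun r : ℝ => Real.sqrt (f (q.2 - r * q.1))) := by
              have := hf.continuous
              fun_prop
            have := this.tendsto 0
            simp only [zero_mul, sub_zero] at this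
            exact this.mono_left nhdsWithin_le_nhds
          have h2 : Tendsto (fun r : ℝ => Real.sqrt (f (q.2 - r * q.1)) / r) (𝓝[>] 0) atTop := by
            simp_rw [div_eq_mul_inv]
            exact h1.pos_mul_atTop (Real.sqrt_pos.2 h0) tendsto_inv_nhdsGT_zero
          filter_upwards [h2.eventually_ge_atTop |hscore f q.2|] with r hr
          unfold pp
          exact max_eq_right (by linarith)
      refine tendsto_const_nhds.congr' ?_
      filter_upwards [this] with r hr
      simp [F, hr]
  simp only [lintegral_zero] at hlim
  refine hlim.congr' ?_
  filter_upwards [self_mem_nhdsWithin] with r hr using (e r hr).symm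

lemma ent_int {g : ℝ → ℝ} {M : ℝ} (hM : ∀ y, g y ≤ M) (h0 : ∀ y, 0 ≤ g y)
    (hg : Integrable g) (hg1 : Integrable (fun y => |y| * g y)) :
    Integrable (fun y => g y * Real.log (g y)) := by
  have hb : Integrable (fun y => (|Real.log M| + 1) * g y + |y| * g y + Real.exp (-|y|)) :=
    ((hg.const_mul _).add hg1).add int_exp_abs
  refine hb.mono' ?_ (ae_of_all _ fun y => ?_)
  · exact Real.continuous_mul_log.comp_aestronglyMeasurable hg.1
  · have hy := h0 y
    rw [Real.norm_eq_abs, abs_le]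
    have h3 := Real.exp_pos (-|y|)
    constructor
    · have := breg_nonneg (h0 y) (Real.exp_pos (-|y|))
      rw [Real.log_exp] at this
      nlinarith [mul_nonneg (abs_nonneg (Real.log M)) hy, mul_nonneg (abs_nonneg y) hy]
    · rcases hy.eq_or_lt with h | h
      · rw [← h]; simp; positivity
      · have : Real.log (g y) ≤ |Real.log M| :=
          (Real.log_le_log h (hM y)).trans (le_abs_self _)
        have := mul_le_mul_of_nonneg_left this hy
        nlinarith [mul_nonneg (abs_nonneg y) hy]

lemma prod_int (μ : Measure ℝ) [IsProbabilityMeasure μ] {k ρ : ℝ → ℝ} (hk : Measurable k)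
    (hki : Integrable k) (hρ : Integrable ρ μ) (s : ℝ) :
    Integrable (fun p : ℝ × ℝ => k (p.1 - s * p.2) * ρ p.2) (volume.prod μ) := by
  rw [integrable_prod_iff']
  · constructor
    · refine ae_of_all _ fun z => ?_
      exact (hki.comp_sub_right (s * z)).mul_const (ρ z)
    · have : (fun z => ∫ y, ‖k (y - s * z) * ρ z‖) = fun z => (∫ y, ‖k y‖) * ‖ρ z‖ := by
        ext z
        simp_rw [norm_mul]
        rw [integral_mul_const, integral_sub_right_eq_self (fun y => ‖k y‖)]
      simp only
      rw [this]
      exact hρ.norm.const_mul _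
  · have h1 : Measurable (fun p : ℝ × ℝ => k (p.1 - s * p.2)) :=
      hk.comp (f := fun p : ℝ × ℝ => p.1 - s * p.2) (by fun_prop)
    exact h1.aestronglyMeasurable.mul hρ.1.comp_snd

noncomputable def FF (f : ℝ → ℝ) (μ : Measure ℝ) (s y : ℝ) : ℝ := ∫ z, f (y - s * z) ∂μ

noncomputable def GG (f : ℝ → ℝ) (μ : Measure ℝ) (s y : ℝ) : ℝ :=
  (∫ z, f (y - s * z) * Real.log (f (y - s * z)) ∂μ) - FF f μ s y * Real.log (FF f μ s y)

lemma f_int_z {f : ℝ → ℝ} (hf : Continuous f) (hpos : ∀ y, 0 ≤ f y) {M : ℝ} (hM : ∀ y, f y ≤ M)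
    (μ : Measure ℝ) [IsProbabilityMeasure μ] (s y : ℝ) :
    Integrable (fun z => f (y - s * z)) μ := by
  refine (integrable_const M).mono' (by fun_prop) (ae_of_all _ fun z => ?_)
  rw [Real.norm_eq_abs, abs_of_nonneg (hpos _)]; exact hM _

lemma phi_int_z {f : ℝ → ℝ} (hf : Continuous f) (hpos : ∀ y, 0 ≤ f y) {M : ℝ} (hM : ∀ y, f y ≤ M)
    (μ : Measure ℝ) [IsProbabilityMeasure μ] (s y : ℝ) :
    Integrable (fun z => f (y - s * z) * Real.log (f (y - s * z))) μ := by
  obtain ⟨C, hC⟩ := (isCompact_Icc (a := (0:ℝ)) (b := M)).exists_bound_of_continuousOn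
    Real.continuous_mul_log.continuousOn
  refine (integrable_const C).mono' ?_ (ae_of_all _ fun z => hC _ ⟨hpos _, hM _⟩)
  exact (Real.continuous_mul_log.comp (g := fun x => x * Real.log x)
    (f := fun z => f (y - s * z)) (by fun_prop)).aestronglyMeasurable

lemma FF_nonneg {f : ℝ → ℝ} (hpos : ∀ y, 0 ≤ f y) (μ : Measure ℝ) (s y : ℝ) : 0 ≤ FF f μ s y :=
  integral_nonneg fun _ => hpos _

lemma FF_le {f : ℝ → ℝ} (hf : Continuous f) (hpos : ∀ y, 0 ≤ f y) {M : ℝ} (hM : ∀ y, f y ≤ M)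
    (μ : Measure ℝ) [IsProbabilityMeasure μ] (s y : ℝ) : FF f μ s y ≤ M := by
  have := integral_mono (f_int_z hf hpos hM μ s y) (integrable_const M) (fun z => hM _)
  unfold FF
  simpa using this

lemma GG_nonneg {f : ℝ → ℝ} (hf : Continuous f) (hpos : ∀ y, 0 ≤ f y) {M : ℝ} (hM : ∀ y, f y ≤ M)
    (μ : Measure ℝ) [IsProbabilityMeasure μ] (s y : ℝ) : 0 ≤ GG f μ s y := by
  have := Real.convexOn_mul_log.map_integral_le (μ := μ) (f := fun z => f (y - s * z))
    Real.continuous_mul_log.continuousOn isClosed_Ici (ae_of_all _ fun z => hpos _)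
    (f_int_z hf hpos hM μ s y) (phi_int_z hf hpos hM μ s y)
  unfold GG FF
  linarith

section
variable {f : ℝ → ℝ} (hf : Continuous f) (hpos : ∀ y, 0 ≤ f y) {M : ℝ} (hM : ∀ y, f y ≤ M)
    (hint : Integrable f) (hvar : Integrable (fun y => y ^ 2 * f y))
    (μ : Measure ℝ) [IsProbabilityMeasure μ] (hμ : Integrable (fun z : ℝ => |z|) μ) (s : ℝ)
include hf hpos hM hint hvar

lemma abs_f_int : Integrable (fun y => |y| * f y) := by
  refine (hint.add hvar).mono' (by fun_prop) (ae_of_all _ fun y => ?_)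
  have := hpos y
  rw [Real.norm_eq_abs, abs_of_nonneg (by positivity)]
  simp only [Pi.add_apply]
  nlinarith [sq_nonneg (|y| - 1), sq_abs y, abs_nonneg y]

lemma phi_f_int : Integrable (fun y => f y * Real.log (f y)) :=
  ent_int hM hpos hint (abs_f_int hf hpos hM hint hvar)

lemma FF_int : Integrable (FF f μ s) := by
  have := (prod_int μ hf.measurable hint (integrable_const (1:ℝ)) s).integral_prod_left
  simp only [mul_one] at this
  exact this

include hμ in
lemma abs_FF_int : Integrable (fun y => |y| * FF f μ s y) := by
  have h1 := (prod_int μ (k := fun y => |y| * f y) (by fun_prop) (abs_f_int hf hpos hM hint hvar)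
    (integrable_const (1:ℝ)) s)
  have h2 := (prod_int μ hf.measurable hint hμ s)
  have h3 : Integrable (fun p : ℝ × ℝ => |p.1| * f (p.1 - s * p.2)) (volume.prod μ) := by
    refine (h1.add (h2.const_mul |s|)).mono' (by fun_prop) (ae_of_all _ fun p => ?_)
    have h4 := hpos (p.1 - s * p.2)
    rw [Real.norm_eq_abs, abs_of_nonneg (by positivity)]
    simp only [Pi.add_apply, mul_one]
    have : |p.1| ≤ |p.1 - s * p.2| + |s| * |p.2| := by
      rw [← abs_mul]
      calc |p.1| = |(p.1 - s * p.2) + s * p.2| := by ring_nf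
        _ ≤ _ := abs_add_le _ _
    nlinarith [mul_le_mul_of_nonneg_right this h4]
  have := h3.integral_prod_left
  simp only [integral_const_mul] at this
  exact this

include hμ in
lemma GG_int : Integrable (GG f μ s) ∧
    (-∫ y, FF f μ s y * Real.log (FF f μ s y)) - (-∫ y, f y * Real.log (f y)) = ∫ y, GG f μ s y := by
  have h1 := ent_int (FF_le hf hpos hM μ s) (FF_nonneg hpos μ s) (FF_int hf hpos hM hint hvar μ s)
    (abs_FF_int hf hpos hM hint hvar μ hμ s)
  have h0 := phi_f_int hf hpos hM hint hvar
  have h2 := prod_int μ (k := fun y => f y * Real.log (f y))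
    (Real.continuous_mul_log.comp hf).measurable h0 (integrable_const (1:ℝ)) s
  simp only [mul_one] at h2
  have h3 := h2.integral_prod_left
  simp only at h3
  refine ⟨h3.sub h1, ?_⟩
  unfold GG
  rw [integral_sub h3 h1]
  have h4 : ∫ y, ∫ z, f (y - s * z) * Real.log (f (y - s * z)) ∂μ = ∫ y, f y * Real.log (f y) := by
    rw [integral_integral_swap h2]
    have : ∀ z : ℝ, ∫ y, f (y - s * z) * Real.log (f (y - s * z)) = ∫ y, f y * Real.log (f y) :=
      fun z => integral_sub_right_eq_self (fun y => f y * Real.log (f y)) (s * z)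
    simp [this]
  rw [h4]; ring
end

lemma GG_upper_pt {f : ℝ → ℝ} (hf : ContDiff ℝ 1 f) (hpos : ∀ y, 0 ≤ f y) {M : ℝ}
    (hM : ∀ y, f y ≤ M) (hne : ∃ x, f x ≠ 0)
    (hJ : Integrable (fun y => (deriv f y) ^ 2 / f y))
    (μ : Measure ℝ) [IsProbabilityMeasure μ] (hμ : Integrable (fun z : ℝ => |z|) μ)
    {s ε : ℝ} (hs : 0 < s) (hε : 0 < ε) (y : ℝ) :
    ENNReal.ofReal (GG f μ s y) ≤
      (∫⁻ z, ENNReal.ofReal (2 * (1 + ε) * (1 + ε * |z|) *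
        (Real.sqrt (f (y - s * z)) - Real.sqrt (f y)) ^ 2) ∂μ) +
      ENNReal.ofReal (2 * (1 + 1 / ε) * (1 + ε * ∫ z, |z| ∂μ) * ((s / ε) ^ 2 * KK)) *
        ENNReal.ofReal (EE f (s / ε) y) := by
  have hcont := hf.continuous
  have hr : 0 < s / ε := by positivity
  set u := Real.sqrt (f y) with hu
  set D := DD f (s / ε) y with hD
  have hD0 : 0 ≤ D := DD_nonneg y hr
  have hu0 : 0 ≤ u := Real.sqrt_nonneg _
  have hb : ∀ z, Real.sqrt (f (y - s * z)) ≤ (u + D) * Real.exp (ε * |z|) := by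
    intro z
    have := DD_bound (y - s * z) y hf hpos hJ hr
    have e : |y - s * z - y| / (s / ε) = ε * |z| := by
      rw [show y - s * z - y = -(s * z) by ring, abs_neg, abs_mul, abs_of_pos hs]
      field_simp
    rwa [e] at this
  have hc : 0 < u + D := by
    rcases (add_nonneg hu0 hD0).eq_or_lt with h | h
    · exfalso
      obtain ⟨x, hx⟩ := hne
      have := hb ((y - x) / s)
      rw [← h, zero_mul] at this
      have e : y - s * ((y - x) / s) = x := by field_simp; ring
      rw [e] at this
      have h2 : 0 < Real.sqrt (f x) := Real.sqrt_pos.2 (lt_of_le_of_ne (hpos x) (Ne.symm hx))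
      linarith
    · exact h
  set c := u + D with hcdef
  have i1 := f_int_z hcont hpos hM μ s y
  have i2 := phi_int_z hcont hpos hM μ s y
  have hA : Integrable (fun z => 2 * (1 + ε) * (1 + ε * |z|) *
        (Real.sqrt (f (y - s * z)) - u) ^ 2) μ := by
    have h1 : Integrable (fun z => 2 * (1 + ε) * (1 + ε * |z|) * M) μ :=
      (((integrable_const (1:ℝ)).add (hμ.const_mul ε)).const_mul _).mul_const _
    refine h1.mono' (by fun_prop) (ae_of_all _ fun z => ?_)
    rw [Real.norm_eq_abs, abs_of_nonneg (by positivity)]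
    gcongr
    have h2 := Real.sq_sqrt (hpos (y - s * z))
    have h3 := Real.sq_sqrt (hpos y)
    rw [← hu] at h3
    have h4 := Real.sqrt_nonneg (f (y - s * z))
    have h5 := hM (y - s * z)
    have h6 := hM y
    rcases le_total (Real.sqrt (f (y - s * z))) u with h | h <;> nlinarith
  have hB : Integrable (fun z => 2 * (1 + 1 / ε) * D ^ 2 * (1 + ε * |z|)) μ :=
    ((integrable_const (1:ℝ)).add (hμ.const_mul ε)).const_mul _
  have hH : Integrable (fun z => f (y - s * z) * Real.log (f (y - s * z)) -
      f (y - s * z) * Real.log (c ^ 2) - f (y - s * z) + c ^ 2) μ :=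
    ((i2.sub (i1.mul_const _)).sub i1).add (integrable_const _)
  have hHe : ∫ z, (f (y - s * z) * Real.log (f (y - s * z)) -
      f (y - s * z) * Real.log (c ^ 2) - f (y - s * z) + c ^ 2) ∂μ =
      (∫ z, f (y - s * z) * Real.log (f (y - s * z)) ∂μ) - FF f μ s y * Real.log (c ^ 2)
        - FF f μ s y + c ^ 2 := by
    have j1 : Integrable (fun z => f (y - s * z) * Real.log (f (y - s * z)) -
      f (y - s * z) * Real.log (c ^ 2)) μ := i2.sub (i1.mul_const _)
    have j2 : Integrable (fun z => f (y - s * z) * Real.log (f (y - s * z)) -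
      f (y - s * z) * Real.log (c ^ 2) - f (y - s * z)) μ := j1.sub i1
    rw [integral_add j2 (integrable_const _), integral_sub j1 i1,
      integral_sub i2 (i1.mul_const _), integral_mul_const]
    simp [FF]
  have hle : GG f μ s y ≤ (∫ z, 2 * (1 + ε) * (1 + ε * |z|) *
        (Real.sqrt (f (y - s * z)) - u) ^ 2 ∂μ) +
        2 * (1 + 1 / ε) * D ^ 2 * (1 + ε * ∫ z, |z| ∂μ) := by
    calc GG f μ s y ≤ ∫ z, (f (y - s * z) * Real.log (f (y - s * z)) -
          f (y - s * z) * Real.log (c ^ 2) - f (y - s * z) + c ^ 2) ∂μ := by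
          rw [hHe]
          have := breg_nonneg (FF_nonneg hpos μ s y) (show 0 < c ^ 2 by positivity)
          unfold GG
          linarith
      _ ≤ ∫ z, (2 * (1 + ε) * (1 + ε * |z|) * (Real.sqrt (f (y - s * z)) - u) ^ 2 +
            2 * (1 + 1 / ε) * D ^ 2 * (1 + ε * |z|)) ∂μ := by
          refine integral_mono hH (hA.add hB) fun z => ?_
          simp only
          set a := Real.sqrt (f (y - s * z)) with ha
          have ha2 : f (y - s * z) = a ^ 2 := (Real.sq_sqrt (hpos _)).symm
          rw [ha2]
          refine (breg_upper (Real.sqrt_nonneg _) hc (by positivity) (hb z)).trans ?_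
          have h1 : (a - c) ^ 2 ≤ (1 + ε) * (a - u) ^ 2 + (1 + 1 / ε) * D ^ 2 := by
            have : (1 + ε) * (a - u) ^ 2 + (1 + 1 / ε) * D ^ 2 - (a - c) ^ 2 =
              (ε * (a - u) + D) ^ 2 / ε := by
              rw [hcdef]; field_simp; ring
            have h2 : 0 ≤ (ε * (a - u) + D) ^ 2 / ε := by positivity
            linarith
          have h3 := mul_le_mul_of_nonneg_left h1 (show 0 ≤ 2 * (1 + ε * |z|) by positivity)
          linarith
      _ = _ := by
          rw [integral_add hA hB, integral_const_mul, integral_add (integrable_const _)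
            (hμ.const_mul ε), integral_const_mul]
          simp
  refine (ENNReal.ofReal_le_ofReal hle).trans ?_
  refine ENNReal.ofReal_add_le.trans ?_
  rw [ofReal_integral_eq_lintegral_ofReal hA (ae_of_all _ fun z => by positivity)]
  refine add_le_add le_rfl ?_
  have hm : 0 ≤ ∫ z, |z| ∂μ := integral_nonneg fun z => abs_nonneg z
  rw [← ENNReal.ofReal_mul (by have := KK_pos; positivity)]
  apply ENNReal.ofReal_le_ofReal
  have h1 := DD_sq y hf hpos hJ hr
  have h2 := mul_le_mul_of_nonneg_left h1
    (show 0 ≤ 2 * (1 + 1 / ε) * (1 + ε * ∫ z, |z| ∂μ) by positivity)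
  linarith

lemma GG_upper {f : ℝ → ℝ} (hf : ContDiff ℝ 1 f) (hpos : ∀ y, 0 ≤ f y) {M : ℝ}
    (hM : ∀ y, f y ≤ M) (hne : ∃ x, f x ≠ 0)
    (hJ : Integrable (fun y => (deriv f y) ^ 2 / f y))
    (μ : Measure ℝ) [IsProbabilityMeasure μ] (hμ : Integrable (fun z : ℝ => |z|) μ)
    (hμ2 : Integrable (fun z : ℝ => z ^ 2) μ) (hμ3 : Integrable (fun z : ℝ => |z| ^ 3) μ)
    (hv : ∫ z, z ^ 2 ∂μ = 1)
    {s ε : ℝ} (hs : 0 < s) (hε : 0 < ε) :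
    ∫⁻ y, ENNReal.ofReal (GG f μ s y) ≤
      ENNReal.ofReal (s ^ 2) * (ENNReal.ofReal (2 * (1 + ε) * (1 + ε * ∫ z, |z| ^ 3 ∂μ) *
        ∫ y, hscore f y ^ 2) +
      ENNReal.ofReal (2 * (1 + 1 / ε) * (1 + ε * ∫ z, |z| ∂μ) * ((1 / ε) ^ 2 * KK)) *
        ∫⁻ y, ENNReal.ofReal (EE f (s / ε) y)) := by
  have hcont := hf.continuous
  have hm : Measurable (fun p : ℝ × ℝ => ENNReal.ofReal (2 * (1 + ε) * (1 + ε * |p.2|) *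
        (Real.sqrt (f (p.1 - s * p.2)) - Real.sqrt (f p.1)) ^ 2)) := by
    have := hcont.measurable
    fun_prop
  have hW : 0 ≤ ∫ y, hscore f y ^ 2 := integral_nonneg fun y => sq_nonneg _
  refine (lintegral_mono fun y => GG_upper_pt hf hpos hM hne hJ μ hμ hs hε y).trans ?_
  rw [lintegral_add_left (Measurable.lintegral_prod_right' hm),
    mul_add (ENNReal.ofReal (s ^ 2)), lintegral_const_mul' _ _ ENNReal.ofReal_ne_top]
  refine add_le_add ?_ ?_
  · rw [lintegral_lintegral_swap hm.aemeasurable]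
    calc _ ≤ ∫⁻ z, ENNReal.ofReal (2 * (1 + ε) * s ^ 2 * (∫ y, hscore f y ^ 2) *
            (z ^ 2 + ε * |z| ^ 3)) ∂μ := by
          refine lintegral_mono fun z => ?_
          have h1 := l2_shift hf hpos hJ (s * z)
          have h0 : 0 ≤ 2 * (1 + ε) * (1 + ε * |z|) := by positivity
          simp_rw [ENNReal.ofReal_mul h0]
          rw [lintegral_const_mul' _ _ ENNReal.ofReal_ne_top]
          refine (mul_le_mul_right h1 _).trans ?_
          rw [← ENNReal.ofReal_mul h0]
          apply ENNReal.ofReal_le_ofReal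
          apply le_of_eq
          rw [show |z| ^ 3 = |z| * z ^ 2 by rw [pow_succ, sq_abs]; ring]
          ring
      _ = _ := by
          have hi : Integrable (fun z : ℝ => z ^ 2 + ε * |z| ^ 3) μ := hμ2.add (hμ3.const_mul ε)
          rw [← ofReal_integral_eq_lintegral_ofReal (hi.const_mul _)
            (ae_of_all _ fun z => by positivity), integral_const_mul,
            integral_add hμ2 (hμ3.const_mul ε), integral_const_mul, hv,
            ← ENNReal.ofReal_mul (by positivity)]
          congr 1; ring
  · rw [← mul_assoc (ENNReal.ofReal (s ^ 2))]
    refine mul_le_mul' ?_ le_rfl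
    rw [← ENNReal.ofReal_mul (by positivity)]
    apply ENNReal.ofReal_le_ofReal
    apply le_of_eq
    field_simp

lemma loc_lip {f : ℝ → ℝ} (hf : ContDiff ℝ 1 f) (hpos : ∀ y, 0 ≤ f y) {M : ℝ}
    (hM : ∀ y, f y ≤ M) (y : ℝ) : ∃ C : ℝ, ∀ h, |f (y - h) - f y| ≤ C * |h| := by
  have h1 : Continuous (deriv f) := hf.continuous_deriv (by norm_num)
  obtain ⟨L, hL⟩ := (isCompact_Icc (a := y - 1) (b := y + 1)).exists_bound_of_continuousOn
    h1.continuousOn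
  refine ⟨max L M, fun h => ?_⟩
  rcases le_total |h| 1 with hh | hh
  · have := Convex.norm_image_sub_le_of_norm_deriv_le (f := f) (C := L) (s := Set.Icc (y - 1) (y + 1))
      (x := y) (y := y - h)
      (fun x _ => (hf.differentiable (by norm_num)).differentiableAt) hL (convex_Icc _ _)
      ⟨by linarith, by linarith⟩ (by rw [abs_le] at hh; constructor <;> linarith)
    simp only [Real.norm_eq_abs] at this
    rw [show y - h - y = -h by ring, abs_neg] at this
    refine this.trans ?_
    gcongr; exact le_max_left _ _
  · have h2 := hpos y
    have h3 := hpos (y - h)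
    have h4 := hM y
    have h5 := hM (y - h)
    have h6 : |f (y - h) - f y| ≤ M := by rw [abs_le]; constructor <;> linarith
    have h7 : M ≤ max L M := le_max_right _ _
    nlinarith

lemma quot_tendsto {f : ℝ → ℝ} (hf : ContDiff ℝ 1 f) (y z : ℝ) :
    Tendsto (fun s : ℝ => (f (y - s * z) - f y) / s) (𝓝[>] 0) (𝓝 (-(z * deriv f y))) := by
  have h0 : HasDerivAt f (deriv f y) (y - 0 * z) := by
    simpa using (hf.differentiable (by norm_num)).differentiableAt.hasDerivAt
  have h1 : HasDerivAt (fun s : ℝ => y - s * z) (-z) 0 := by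
    simpa using ((hasDerivAt_id (0:ℝ)).mul_const z).const_sub y
  have h2 := h0.comp (0:ℝ) h1
  rw [hasDerivAt_iff_tendsto_slope_zero] at h2
  have h3 := h2.mono_left (nhdsWithin_mono 0 (fun x hx => (ne_of_gt hx : x ≠ 0)) : 𝓝[>] (0:ℝ) ≤ 𝓝[≠] 0)
  have e : -(z * deriv f y) = deriv f y * -z := by ring
  rw [e]
  refine h3.congr fun s => ?_
  simp [div_eq_inv_mul]

lemma FF_quot {f : ℝ → ℝ} (hf : ContDiff ℝ 1 f) (hpos : ∀ y, 0 ≤ f y) {M : ℝ}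
    (hM : ∀ y, f y ≤ M) (μ : Measure ℝ) [IsProbabilityMeasure μ]
    (hμ : Integrable (fun z : ℝ => |z|) μ) (hmean : ∫ z, z ∂μ = 0) (y : ℝ) :
    Tendsto (fun s : ℝ => (FF f μ s y - f y) / s) (𝓝[>] 0) (𝓝 0) := by
  obtain ⟨C, hC⟩ := loc_lip hf hpos hM y
  have hcont := hf.continuous
  have h1 : Tendsto (fun s : ℝ => ∫ z, (f (y - s * z) - f y) / s ∂μ) (𝓝[>] 0)
      (𝓝 (∫ z, -(z * deriv f y) ∂μ)) := by
    refine tendsto_integral_filter_of_dominated_convergence (fun z => C * |z|) ?_ ?_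
      (hμ.const_mul C) (ae_of_all _ fun z => quot_tendsto hf y z)
    · exact Eventually.of_forall fun s => by fun_prop
    · filter_upwards [self_mem_nhdsWithin] with s hs
      have hs' : (0:ℝ) < s := hs
      refine ae_of_all _ fun z => ?_
      rw [Real.norm_eq_abs, abs_div, abs_of_pos hs', div_le_iff₀ hs']
      have := hC (s * z)
      rw [abs_mul, abs_of_pos hs'] at this
      linarith
  rw [integral_neg, integral_mul_const, hmean] at h1
  simp only [zero_mul, neg_zero] at h1
  refine h1.congr fun s => ?_
  rw [integral_div, integral_sub (f_int_z hcont hpos hM μ s y) (integrable_const _)]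
  simp [FF]

lemma GG_lower_pt {f : ℝ → ℝ} (hf : ContDiff ℝ 1 f) (hpos : ∀ y, 0 ≤ f y) {M : ℝ}
    (hM : ∀ y, f y ≤ M) (μ : Measure ℝ) [IsProbabilityMeasure μ]
    (hμ : Integrable (fun z : ℝ => |z|) μ) (hmean : ∫ z, z ∂μ = 0)
    (hμ2 : Integrable (fun z : ℝ => z ^ 2) μ) (hv : ∫ z, z ^ 2 ∂μ = 1) (y : ℝ) :
    ENNReal.ofReal (deriv f y ^ 2 / (2 * f y)) ≤
      liminf (fun s : ℝ => ENNReal.ofReal (GG f μ s y / s ^ 2)) (𝓝[>] 0) := by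
  have hcont := hf.continuous
  rcases (hpos y).eq_or_lt with h0 | h0
  · rw [← h0]; simp
  have hFq := FF_quot hf hpos hM μ hμ hmean y
  have hs0 : Tendsto (fun s : ℝ => s) (𝓝[>] 0) (𝓝 0) := nhdsWithin_le_nhds
  have hF : Tendsto (fun s : ℝ => FF f μ s y) (𝓝[>] 0) (𝓝 (f y)) := by
    have := (hFq.mul hs0).add_const (f y)
    simp only [zero_mul, zero_add] at this
    refine this.congr' ?_
    filter_upwards [self_mem_nhdsWithin] with s hs
    have : s ≠ 0 := ne_of_gt hs
    field_simp
    ring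
  let Q : ℝ → ℝ → ENNReal := fun s z => ENNReal.ofReal
    ((f (y - s * z) - FF f μ s y) ^ 2 / (2 * max (f (y - s * z)) (FF f μ s y)) / s ^ 2)
  have hQ : ∀ z, Tendsto (fun s => Q s z) (𝓝[>] 0)
      (𝓝 (ENNReal.ofReal (z ^ 2 * (deriv f y ^ 2 / (2 * f y))))) := by
    intro z
    apply ENNReal.tendsto_ofReal
    have h1 : Tendsto (fun s : ℝ => (f (y - s * z) - FF f μ s y) / s) (𝓝[>] 0)
        (𝓝 (-(z * deriv f y) - 0)) := by
      refine ((quot_tendsto hf y z).sub hFq).congr fun s => ?_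
      ring
    have h2 : Tendsto (fun s : ℝ => f (y - s * z)) (𝓝[>] 0) (𝓝 (f y)) := by
      have : Continuous (fun s : ℝ => f (y - s * z)) := by fun_prop
      have := this.tendsto 0
      simp only [zero_mul, sub_zero] at this
      exact this.mono_left nhdsWithin_le_nhds
    have h3 := ((h1.pow 2).div ((h2.max hF).const_mul 2) (by rw [max_self]; positivity))
    rw [max_self] at h3
    have e : z ^ 2 * (deriv f y ^ 2 / (2 * f y)) = (-(z * deriv f y) - 0) ^ 2 / (2 * f y) := by ring
    rw [e]
    refine h3.congr fun s => ?_
    simp only [Pi.div_apply, Pi.pow_apply]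
    rw [div_pow, div_right_comm]
  calc ENNReal.ofReal (deriv f y ^ 2 / (2 * f y))
      = ∫⁻ z, ENNReal.ofReal (z ^ 2 * (deriv f y ^ 2 / (2 * f y))) ∂μ := by
        rw [← ofReal_integral_eq_lintegral_ofReal (hμ2.mul_const _)
          (ae_of_all _ fun z => by positivity), integral_mul_const, hv, one_mul]
    _ = ∫⁻ z, liminf (fun s => Q s z) (𝓝[>] 0) ∂μ := by
        congr 1; ext z; exact (hQ z).liminf_eq.symm
    _ ≤ liminf (fun s => ∫⁻ z, Q s z ∂μ) (𝓝[>] 0) := by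
        apply lintegral_liminf_le
        intro s
        have := hcont.measurable
        simp only [Q]
        fun_prop
    _ ≤ _ := by
        refine liminf_le_liminf ?_
        filter_upwards [self_mem_nhdsWithin, hF.eventually_const_lt h0] with s hs hFs
        have i1 := f_int_z hcont hpos hM μ s y
        have i2 := phi_int_z hcont hpos hM μ s y
        set F := FF f μ s y with hFdef
        have j1 : Integrable (fun z => f (y - s * z) * Real.log (f (y - s * z)) -
          f (y - s * z) * Real.log F) μ := i2.sub (i1.mul_const _)
        have j2 : Integrable (fun z => f (y - s * z) * Real.log (f (y - s * z)) -
          f (y - s * z) * Real.log F - f (y - s * z)) μ := j1.sub i1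
        have j3 : Integrable (fun z => f (y - s * z) * Real.log (f (y - s * z)) -
          f (y - s * z) * Real.log F - f (y - s * z) + F) μ := j2.add (integrable_const _)
        have e : GG f μ s y = ∫ z, (f (y - s * z) * Real.log (f (y - s * z)) -
          f (y - s * z) * Real.log F - f (y - s * z) + F) ∂μ := by
          rw [integral_add j2 (integrable_const _), integral_sub j1 i1,
            integral_sub i2 (i1.mul_const _), integral_mul_const]
          have : ∫ z, f (y - s * z) ∂μ = F := rfl
          rw [this, GG, ← hFdef]
          simp
        rw [e, ← integral_div, ofReal_integral_eq_lintegral_ofReal (j3.div_const _)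
          (ae_of_all _ fun z => div_nonneg (breg_nonneg (hpos _) hFs) (sq_nonneg s))]
        refine lintegral_mono fun z => ENNReal.ofReal_le_ofReal ?_
        gcongr
        exact breg_lower (hpos _) hFs

lemma main_tendsto {f : ℝ → ℝ} (hf : ContDiff ℝ 1 f) (hpos : ∀ y, 0 ≤ f y)
    (hdens : ∫ y, f y = 1) (hvar : Integrable (fun y => y ^ 2 * f y))
    (hJ : Integrable (fun y => (deriv f y) ^ 2 / f y))
    (μ : Measure ℝ) [IsProbabilityMeasure μ] (hμ : Integrable (fun z : ℝ => |z|) μ)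
    (hμ2 : Integrable (fun z : ℝ => z ^ 2) μ) (hμ3 : Integrable (fun z : ℝ => |z| ^ 3) μ)
    (hmean : ∫ z, z ∂μ = 0) (hv : ∫ z, z ^ 2 ∂μ = 1) :
    Tendsto (fun s : ℝ => (diffEntropy (FF f μ s) - diffEntropy f) / s ^ 2) (𝓝[>] 0)
      (𝓝 ((1 / 2) * fisherInfo f)) := by
  have hcont := hf.continuous
  have hint : Integrable f := by
    by_contra h
    rw [integral_undef h] at hdens
    norm_num at hdens
  have hne : ∃ x, f x ≠ 0 := by
    by_contra! h
    simp [h] at hdens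
  obtain ⟨M, -, hM⟩ := bounded_f hf hpos hint hJ
  have hG := fun s => (GG_int hcont hpos hM hint hvar μ hμ s).1
  have hGe : ∀ s, diffEntropy (FF f μ s) - diffEntropy f = ∫ y, GG f μ s y :=
    fun s => (GG_int hcont hpos hM hint hvar μ hμ s).2
  have hG0 := fun s => GG_nonneg hcont hpos hM μ s
  have hlin : ∀ s, ENNReal.ofReal (∫ y, GG f μ s y) = ∫⁻ y, ENNReal.ofReal (GG f μ s y) :=
    fun s => ofReal_integral_eq_lintegral_ofReal (hG s) (ae_of_all _ (hG0 s))
  simp_rw [hGe]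
  have hW : fisherInfo f = 4 * ∫ y, hscore f y ^ 2 := by
    simp_rw [hscore_sq hpos]
    rw [integral_const_mul, fisherInfo]; ring
  set W := ∫ y, hscore f y ^ 2 with hWdef
  have hW0 : 0 ≤ W := integral_nonneg fun y => sq_nonneg _
  set m3 := ∫ z, |z| ^ 3 ∂μ with hm3
  have hm30 : 0 ≤ m3 := integral_nonneg fun z => by positivity
  rw [tendsto_order]
  constructor
  · intro a ha
    rcases lt_or_ge a 0 with ha0 | ha0
    · filter_upwards with s
      exact lt_of_lt_of_le ha0 (div_nonneg (integral_nonneg (hG0 s)) (sq_nonneg s))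
    have h1 : ENNReal.ofReal ((1 / 2) * fisherInfo f) ≤
        liminf (fun s : ℝ => ∫⁻ y, ENNReal.ofReal (GG f μ s y / s ^ 2)) (𝓝[>] 0) := by
      calc _ = ∫⁻ y, ENNReal.ofReal (deriv f y ^ 2 / (2 * f y)) := by
            have e : ∀ y, deriv f y ^ 2 / (2 * f y) = (1 / 2) * (deriv f y ^ 2 / f y) := by
              intro y; ring
            simp_rw [e]
            rw [← ofReal_integral_eq_lintegral_ofReal (hJ.const_mul _)
              (ae_of_all _ fun y => by have := hpos y; positivity), integral_const_mul, fisherInfo]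
        _ ≤ ∫⁻ y, liminf (fun s : ℝ => ENNReal.ofReal (GG f μ s y / s ^ 2)) (𝓝[>] 0) :=
            lintegral_mono fun y => GG_lower_pt hf hpos hM μ hμ hmean hμ2 hv y
        _ ≤ _ := lintegral_liminf_le' fun s => ((hG s).div_const _).1.aemeasurable.ennreal_ofReal
    have h2 : ENNReal.ofReal a < ENNReal.ofReal ((1 / 2) * fisherInfo f) :=
      (ENNReal.ofReal_lt_ofReal_iff (by linarith)).2 ha
    have h3 := eventually_lt_of_lt_liminf (lt_of_lt_of_le h2 h1)
    filter_upwards [h3] with s hs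
    rw [← ofReal_integral_eq_lintegral_ofReal ((hG s).div_const _)
      (ae_of_all _ fun y => div_nonneg (hG0 s y) (sq_nonneg s)), integral_div] at hs
    exact (ENNReal.ofReal_lt_ofReal_iff_of_nonneg ha0).1 hs
  · intro b hb
    rw [hW] at hb
    have h1 : Tendsto (fun ε : ℝ => 2 * (1 + ε) * (1 + ε * m3) * W) (𝓝[>] 0)
        (𝓝 (2 * (1 + 0) * (1 + 0 * m3) * W)) := by
      have : Continuous (fun ε : ℝ => 2 * (1 + ε) * (1 + ε * m3) * W) := by fun_prop
      exact (this.tendsto 0).mono_left nhdsWithin_le_nhds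
    obtain ⟨ε, hεb, hε⟩ := ((h1.eventually_lt_const (show _ < b by linarith)).and
      self_mem_nhdsWithin).exists
    have hε' : (0:ℝ) < ε := hε
    have hb0 : 0 < b := by linarith
    set Cε := ENNReal.ofReal (2 * (1 + 1 / ε) * (1 + ε * ∫ z, |z| ∂μ) * ((1 / ε) ^ 2 * KK))
    have hdiv : Tendsto (fun s : ℝ => s / ε) (𝓝[>] 0) (𝓝[>] 0) := by
      refine tendsto_nhdsWithin_of_tendsto_nhds_of_eventually_within _ ?_ ?_
      · have : Continuous (fun s : ℝ => s / ε) := by fun_prop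
        have := this.tendsto 0
        rw [zero_div] at this
        exact this.mono_left nhdsWithin_le_nhds
      · filter_upwards [self_mem_nhdsWithin] with s hs
        exact div_pos hs hε'
    have h2 := (ENNReal.Tendsto.const_mul ((EE_tendsto hf hpos hJ).comp hdiv)
      (Or.inr (ENNReal.ofReal_ne_top : Cε ≠ ⊤))).const_add
      (ENNReal.ofReal (2 * (1 + ε) * (1 + ε * m3) * W))
    rw [mul_zero, add_zero] at h2
    have h3 := h2.eventually_lt_const ((ENNReal.ofReal_lt_ofReal_iff hb0).2 hεb)
    filter_upwards [h3, self_mem_nhdsWithin] with s hs hs0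
    have hs0' : (0:ℝ) < s := hs0
    have h4 := GG_upper hf hpos hM hne hJ μ hμ hμ2 hμ3 hv hs0' hε'
    rw [← hlin] at h4
    have h5 : ENNReal.ofReal (∫ y, GG f μ s y) < ENNReal.ofReal (s ^ 2) * ENNReal.ofReal b := by
      refine lt_of_le_of_lt h4 ?_
      refine ENNReal.mul_lt_mul_right ?_ ENNReal.ofReal_ne_top hs
      simp only [ne_eq, ENNReal.ofReal_eq_zero, not_le]
      positivity
    rw [← ENNReal.ofReal_mul (by positivity), ENNReal.ofReal_lt_ofReal_iff (by positivity)] at h5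
    rw [div_lt_iff₀ (by positivity)]
    linarith

theorem stmt8 (fP fQ : ℝ → ℝ)
    (hPsmooth : ContDiff ℝ (⊤ : ℕ∞) fP) (hPpos : ∀ y, 0 ≤ fP y)
    (hPdens : ∫ y, fP y = 1)
    (hPvar : Integrable (fun y => y ^ 2 * fP y))
    (hPfisher : Integrable (fun y => (deriv fP y) ^ 2 / fP y))
    (hQpos : ∀ y, 0 ≤ fQ y) (hQdens : ∫ y, fQ y = 1)
    (hQsymm : ∀ y, fQ y = fQ (-y))
    (hQmean : ∫ y, y * fQ y = 0)
    (hQvar : ∫ y, y ^ 2 * fQ y = 1)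
    (hQmoments : ∀ n : ℕ, Integrable (fun y => y ^ n * fQ y)) :
    Tendsto
      (fun δ : ℝ => (diffEntropy (convPert fP fQ δ) - diffEntropy fP) / δ)
      (𝓝[>] 0) (𝓝 ((1 / 2) * fisherInfo fP)) := by
  have hQi : Integrable fQ := by simpa using hQmoments 0
  set μ : Measure ℝ := volume.withDensity (fun z => ENNReal.ofReal (fQ z)) with hμdef
  have hm : AEMeasurable (fun z => ENNReal.ofReal (fQ z)) volume :=
    hQi.1.aemeasurable.ennreal_ofReal
  have hlt : ∀ᵐ z : ℝ, ENNReal.ofReal (fQ z) < ⊤ := ae_of_all _ fun z => ENNReal.ofReal_lt_top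
  have hI : ∀ g : ℝ → ℝ, ∫ z, g z ∂μ = ∫ z, g z * fQ z := by
    intro g
    rw [hμdef, integral_withDensity_eq_integral_toReal_smul₀ hm hlt]
    congr 1; ext z
    rw [ENNReal.toReal_ofReal (hQpos z), smul_eq_mul, mul_comm]
  have hIn : ∀ g : ℝ → ℝ, Integrable g μ ↔ Integrable (fun z => g z * fQ z) := by
    intro g
    rw [hμdef, integrable_withDensity_iff_integrable_smul₀' hm hlt]
    have : (fun z => (ENNReal.ofReal (fQ z)).toReal • g z) = fun z => g z * fQ z := by
      ext z
      rw [ENNReal.toReal_ofReal (hQpos z), smul_eq_mul, mul_comm]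
    rw [this]
  haveI : IsProbabilityMeasure μ := by
    constructor
    rw [hμdef, withDensity_apply _ MeasurableSet.univ, Measure.restrict_univ,
      ← ofReal_integral_eq_lintegral_ofReal hQi (ae_of_all _ hQpos), hQdens, ENNReal.ofReal_one]
  have hn : ∀ n : ℕ, Integrable (fun z : ℝ => z ^ n) μ := fun n => (hIn _).2 (hQmoments n)
  have h1 : Integrable (fun z : ℝ => |z|) μ := by
    have := (hn 1).abs
    simpa using this
  have h3 : Integrable (fun z : ℝ => |z| ^ 3) μ := by
    have := (hn 3).abs
    simpa only [abs_pow] using this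
  have key := main_tendsto (hPsmooth.of_le (by exact_mod_cast le_top)) hPpos hPdens hPvar hPfisher
    μ h1 (hn 2) h3 (by rw [hI]; exact hQmean) (by rw [hI]; exact hQvar)
  have hsq : Tendsto Real.sqrt (𝓝[>] 0) (𝓝[>] 0) := by
    refine tendsto_nhdsWithin_of_tendsto_nhds_of_eventually_within _ ?_ ?_
    · have := Real.continuous_sqrt.tendsto 0
      rw [Real.sqrt_zero] at this
      exact this.mono_left nhdsWithin_le_nhds
    · filter_upwards [self_mem_nhdsWithin] with s hs
      exact Real.sqrt_pos.2 hs
  refine (key.comp hsq).congr' ?_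
  filter_upwards [self_mem_nhdsWithin] with δ hδ
  have e : convPert fP fQ δ = FF fP μ (Real.sqrt δ) := by
    ext y
    rw [convPert, FF, hI (fun z => fP (y - Real.sqrt δ * z))]
  simp only [Function.comp]
  rw [Real.sq_sqrt (le_of_lt hδ), e]
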